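/- Let (X,d) be a compact (R,D)-thin metric space. Let l : [0,Λ] → X be a segment of maximal length in X (every segment in X has length ≤ Λ) and assume Λ ≥ 10R. Let p ∈ X with dist(p, l([0,Λ])) ≥ 10R, let γ₁ be a segment connecting p and l(Λ), and let γ₂ be a segment connecting p and l(0). Let {b₁, b₂, b₃} = {γ₁, γ₂, l}, write bᵢ : [0, Lᵢ] → X, and suppose b₁(0) does not lie in the image of b₂. Then: (1) d(b₁(0), b₂(L₂/2)) ≥ min{L₁, L₃} + L₂/2 − 10R; and (2) d(b₁(L₁/2), b₂(L₂/2)) ≥ L₁/2 + L₂/2 − 10R. -/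

import Mathlib

open Metric Set

/-- `l` restricted to `[a, b]` is a unit-speed segment (isometric embedding of `[a,b]`). -/
def IsSegmentOn {X : Type*} [PseudoMetricSpace X] (l : ℝ → X) (a b : ℝ) : Prop :=
  ∀ s ∈ Set.Icc a b, ∀ t ∈ Set.Icc a b, dist (l s) (l t) = |s - t|

/-- A ray in `X`: an isometric embedding of `[0, ∞)`. -/
def IsRay {X : Type*} [PseudoMetricSpace X] (r : ℝ → X) : Prop :=
  ∀ s t : ℝ, 0 ≤ s → 0 ≤ t → dist (r s) (r t) = |s - t|

/-- `X` is a geodesic space: any two points are joined by a segment. -/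
def IsGeodesicSpace (X : Type*) [PseudoMetricSpace X] : Prop :=
  ∀ x y : X, ∃ f : ℝ → X, IsSegmentOn f 0 (dist x y) ∧ f 0 = x ∧ f (dist x y) = y

/-- The metric projection of a point `x` to a set `K`:
the set of points of `K` realizing the distance from `x` to `K`. -/
def metricProj {X : Type*} [PseudoMetricSpace X] (K : Set X) (x : X) : Set X :=
  {y ∈ K | dist x y = Metric.infDist x K}

/-- The metric projection of a set `A` to a set `K`. -/
def metricProjSet {X : Type*} [PseudoMetricSpace X] (K A : Set X) : Set X :=
  ⋃ x ∈ A, metricProj K x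

/-- `S` contains a `c`-net of `T`: every point of `T` is within distance `c` of `S`. -/
def ContainsNetOf {X : Type*} [PseudoMetricSpace X] (S T : Set X) (c : ℝ) : Prop :=
  ∀ p ∈ T, ∃ q ∈ S, dist p q ≤ c

/-- An `(R,D)`-thin metric space: a proper, separable, geodesic metric space
(with `R ≥ 20 D > 0`) such that for every segment `l` of length `L > 2R`, every
`t ∈ (R, L - R)` and every `x` whose projection to `l` meets `l(t)`, one has
`dist(x, l) < D`. -/
structure IsThinSpace (X : Type*) [MetricSpace X] (R D : ℝ) : Prop where
  R_pos : 0 < R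
  D_pos : 0 < D
  twentyD_le_R : 20 * D ≤ R
  proper : ProperSpace X
  separable : TopologicalSpace.SeparableSpace X
  geodesic : IsGeodesicSpace X
  thin : ∀ (l : ℝ → X) (L : ℝ), 2 * R < L → IsSegmentOn l 0 L →
    ∀ t ∈ Set.Ioo R (L - R), ∀ x : X,
      dist x (l t) = Metric.infDist x (l '' Set.Icc 0 L) →
      Metric.infDist x (l '' Set.Icc 0 L) < D

theorem IsSegmentOn.continuousOn {X : Type*} [PseudoMetricSpace X] {f : ℝ → X} {a b : ℝ}
    (hf : IsSegmentOn f a b) : ContinuousOn f (Set.Icc a b) := by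
  have h : LipschitzOnWith 1 f (Set.Icc a b) :=
    LipschitzOnWith.of_dist_le_mul fun s hs t ht => by
      simp [hf s hs t ht, Real.dist_eq]
  exact h.continuousOn

theorem IsSegmentOn.reverse {X : Type*} [PseudoMetricSpace X] {f : ℝ → X} {L : ℝ}
    (hf : IsSegmentOn f 0 L) : IsSegmentOn (fun s => f (L - s)) 0 L := by
  intro s hs t ht
  rw [hf (L - s) ⟨by linarith [hs.2], by linarith [hs.1]⟩
    (L - t) ⟨by linarith [ht.2], by linarith [ht.1]⟩, abs_sub_comm]
  congr 1
  ring

theorem image_reverse_Icc {X : Type*} (f : ℝ → X) (L : ℝ) :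
    (fun s => f (L - s)) '' Set.Icc 0 L = f '' Set.Icc 0 L := by
  rw [← Set.image_image f (fun s => L - s)]
  simp

/-- A geodesic from a point `D`-far from a segment to a point of the segment has to pass close
to one of the endpoints of the segment. -/
theorem IsThinSpace.min_dist_endpoints_le {X : Type*} [MetricSpace X] {R D : ℝ}
    (hX : IsThinSpace X R D) {f : ℝ → X} {L : ℝ} (hL : 2 * R < L) (hf : IsSegmentOn f 0 L)
    {x : X} (hx : D ≤ Metric.infDist x (f '' Set.Icc 0 L)) {s : ℝ} (hs : s ∈ Set.Icc 0 L) :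
    min (dist x (f 0) + s) (dist x (f L) + (L - s)) - 2 * R - 2 * D ≤ dist x (f s) := by
  have hR := hX.R_pos
  have hD := hX.D_pos
  have hL0 : 0 ≤ L := by linarith
  obtain ⟨σ, hσ, hσ0, hσ1⟩ := hX.geodesic x (f s)
  have hN : 0 ≤ dist x (f s) := dist_nonneg
  have hcont : ContinuousOn (fun u => Metric.infDist (σ u) (f '' Set.Icc 0 L))
      (Set.Icc 0 (dist x (f s))) :=
    (Metric.continuous_infDist_pt _).comp_continuousOn hσ.continuousOn
  have hD_mem : D ∈ Set.Icc (Metric.infDist (σ (dist x (f s))) (f '' Set.Icc 0 L))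
      (Metric.infDist (σ 0) (f '' Set.Icc 0 L)) := by
    rw [hσ1, hσ0, Metric.infDist_zero_of_mem (Set.mem_image_of_mem f hs)]
    exact ⟨hD.le, hx⟩
  obtain ⟨u, hu, huD⟩ := intermediate_value_Icc' hN hcont hD_mem
  have hK : IsCompact (f '' Set.Icc 0 L) := isCompact_Icc.image_of_continuousOn hf.continuousOn
  obtain ⟨_, ⟨t, ht, rfl⟩, hqt⟩ :=
    hK.exists_infDist_eq_dist (Set.nonempty_of_mem (Set.mem_image_of_mem f hs)) (σ u)
  replace huD : Metric.infDist (σ u) (f '' Set.Icc 0 L) = D := huD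
  have ht_end : t ≤ R ∨ L - R ≤ t := by
    by_contra! h
    exact (hX.thin f L hL hf t h (σ u) hqt.symm).ne huD
  have hqtD : dist (σ u) (f t) = D := hqt.symm.trans huD
  have hxq : dist x (σ u) = u := by
    have h := hσ 0 ⟨le_rfl, hN⟩ u hu
    rwa [hσ0, zero_sub, abs_neg, abs_of_nonneg hu.1] at h
  have hqs : dist (σ u) (f s) = dist x (f s) - u := by
    have h := hσ u hu _ ⟨hN, le_rfl⟩
    rwa [hσ1, abs_sub_comm, abs_of_nonneg (by linarith [hu.2])] at h
  have hts := hf t ht s hs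
  have h₁ := dist_triangle x (σ u) (f t)
  have h₂ := dist_triangle_left (f t) (f s) (σ u)
  rcases ht_end with h | h
  · have h₃ := dist_triangle x (f t) (f 0)
    rw [hf t ht 0 ⟨le_rfl, hL0⟩, sub_zero, abs_of_nonneg ht.1] at h₃
    have := neg_le_abs (t - s)
    have := min_le_left (dist x (f 0) + s) (dist x (f L) + (L - s))
    linarith
  · have h₃ := dist_triangle x (f t) (f L)
    rw [hf t ht L ⟨hL0, le_rfl⟩, abs_sub_comm, abs_of_nonneg (by linarith [ht.2])] at h₃
    have := le_abs_self (t - s)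
    have := min_le_right (dist x (f 0) + s) (dist x (f L) + (L - s))
    linarith

/-- A segment `γ` of length at most `Λ`, from a point far from the segment `l` to the endpoint
`l Λ`, stays away from the other endpoint `l 0`. -/
theorem IsSegmentOn.le_infDist_opposite_endpoint {X : Type*} [MetricSpace X] {D : ℝ}
    {l : ℝ → X} {Λ : ℝ} (hΛ : 0 ≤ Λ) (hl : IsSegmentOn l 0 Λ)
    {γ : ℝ → X} {L : ℝ} (hL : 0 ≤ L) (hLΛ : L ≤ Λ) (hγ : IsSegmentOn γ 0 L) (hγ1 : γ L = l Λ)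
    (hp : 2 * D ≤ Metric.infDist (γ 0) (l '' Set.Icc 0 Λ)) :
    D ≤ Metric.infDist (l 0) (γ '' Set.Icc 0 L) := by
  by_contra! h
  obtain ⟨_, ⟨u, hu, rfl⟩, hlu⟩ :=
    (Metric.infDist_lt_iff ((Set.nonempty_Icc.2 hL).image γ)).1 h
  have h₁ := hl 0 ⟨le_rfl, hΛ⟩ Λ ⟨hΛ, le_rfl⟩
  rw [zero_sub, abs_neg, abs_of_nonneg hΛ] at h₁
  have h₂ := hγ u hu L ⟨hL, le_rfl⟩
  rw [hγ1, abs_sub_comm, abs_of_nonneg (by linarith [hu.2])] at h₂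
  have h₃ := hγ 0 ⟨le_rfl, hL⟩ u hu
  rw [zero_sub, abs_neg, abs_of_nonneg hu.1] at h₃
  have h₄ := dist_triangle (l 0) (γ u) (l Λ)
  have h₅ := dist_triangle_right (γ 0) (l 0) (γ u)
  have h₆ := Metric.infDist_le_dist_of_mem (x := γ 0)
    (Set.mem_image_of_mem l (Set.left_mem_Icc.2 hΛ))
  linarith

theorem IsThinSpace.dist_opposite_endpoint_midpoint_ge {X : Type*} [MetricSpace X] {R D : ℝ}
    (hX : IsThinSpace X R D) {l : ℝ → X} {Λ : ℝ} (hΛ : 0 ≤ Λ) (hl : IsSegmentOn l 0 Λ)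
    {γ : ℝ → X} {L : ℝ} (hLΛ : L ≤ Λ) (hγ : IsSegmentOn γ 0 L) (hγ1 : γ L = l Λ)
    (hp : 10 * R ≤ Metric.infDist (γ 0) (l '' Set.Icc 0 Λ)) (hL : 10 * R ≤ L) :
    min Λ (dist (γ 0) (l 0)) + L / 2 - 2 * R - 2 * D ≤ dist (l 0) (γ (L / 2)) := by
  have hR := hX.R_pos
  have hD := hX.D_pos
  have hRD := hX.twentyD_le_R
  have h := hX.min_dist_endpoints_le (by linarith) hγ
    (hl.le_infDist_opposite_endpoint (D := D) hΛ (by linarith) hLΛ hγ hγ1 (by linarith))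
    (s := L / 2) ⟨by linarith, by linarith⟩
  have hlΛ := hl 0 ⟨le_rfl, hΛ⟩ Λ ⟨hΛ, le_rfl⟩
  rw [zero_sub, abs_neg, abs_of_nonneg hΛ] at hlΛ
  rw [hγ1, hlΛ, sub_half, min_add_add_right, dist_comm (l 0), min_comm] at h
  exact h

theorem IsThinSpace.dist_midpoints_ge {X : Type*} [MetricSpace X] {R D : ℝ}
    (hX : IsThinSpace X R D) {l : ℝ → X} {Λ : ℝ} (hΛ : 10 * R ≤ Λ) (hl : IsSegmentOn l 0 Λ)
    {γ : ℝ → X} {L : ℝ} (hLΛ : L ≤ Λ) (hγ : IsSegmentOn γ 0 L) (hγ1 : γ L = l Λ)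
    (hp : 10 * R ≤ Metric.infDist (γ 0) (l '' Set.Icc 0 Λ)) (hL : 10 * R ≤ L) :
    L / 2 + Λ / 2 - 10 * R ≤ dist (γ (L / 2)) (l (Λ / 2)) := by
  have hR := hX.R_pos
  have hD := hX.D_pos
  have hRD := hX.twentyD_le_R
  have hΛ0 : 0 ≤ Λ := by linarith
  have hL0 : 0 ≤ L := by linarith
  have hp0 : 10 * R ≤ dist (γ 0) (l 0) :=
    hp.trans (Metric.infDist_le_dist_of_mem (Set.mem_image_of_mem l (Set.left_mem_Icc.2 hΛ0)))
  have hmid : L / 2 ∈ Set.Icc 0 L := ⟨by linarith, by linarith⟩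
  have hmΛ := hγ (L / 2) hmid L ⟨hL0, le_rfl⟩
  rw [hγ1, abs_sub_comm, sub_half, abs_of_nonneg hmid.1] at hmΛ
  have hpm := hγ 0 ⟨le_rfl, hL0⟩ (L / 2) hmid
  rw [zero_sub, abs_neg, abs_of_nonneg hmid.1] at hpm
  rcases le_or_gt D (Metric.infDist (γ (L / 2)) (l '' Set.Icc 0 Λ)) with hfar | hnear
  · have h₁ := hX.min_dist_endpoints_le (by linarith) hl hfar (s := Λ / 2)
      ⟨by linarith, by linarith⟩
    rw [sub_half, min_add_add_right, hmΛ] at h₁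
    have h₂ := hX.dist_opposite_endpoint_midpoint_ge hΛ0 hl hLΛ hγ hγ1 hp hL
    have h₃ : 10 * R ≤ min Λ (dist (γ 0) (l 0)) := le_min hΛ hp0
    have h₄ : L / 2 ≤ min (dist (γ (L / 2)) (l 0)) (L / 2) :=
      le_min (by rw [dist_comm]; linarith) le_rfl
    linarith
  · obtain ⟨_, ⟨t, ht, rfl⟩, hmt⟩ :=
      (Metric.infDist_lt_iff ((Set.nonempty_Icc.2 hΛ0).image l)).1 hnear
    have htΛ := hl t ht Λ ⟨hΛ0, le_rfl⟩
    rw [abs_sub_comm, abs_of_nonneg (by linarith [ht.2])] at htΛ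
    have h₁ := dist_triangle (γ (L / 2)) (l t) (l Λ)
    have h₂ := dist_triangle_left (l t) (l Λ) (γ (L / 2))
    have h₃ := dist_triangle (γ 0) (γ (L / 2)) (l t)
    have h₄ := hX.min_dist_endpoints_le (by linarith) hl (by linarith) ht (x := γ 0)
    have hpΛ := hγ 0 ⟨le_rfl, hL0⟩ L ⟨hL0, le_rfl⟩
    rw [hγ1, zero_sub, abs_neg, abs_of_nonneg hL0] at hpΛ
    rcases min_choice (dist (γ 0) (l 0) + t) (dist (γ 0) (l Λ) + (Λ - t)) with h | h <;>
      rw [h] at h₄ <;> linarith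

/-- Corollary 4.15: with `l` a maximal segment of length `Λ ≥ 10R`
in a compact `(R,D)`-thin space, `p` at distance `≥ 10R` from `l`, and `γ₁, γ₂` segments
from `p` to the endpoints of `l`: for any enumeration `{b₁,b₂,b₃} = {γ₁,γ₂,l}` with
`b₁(0)` not on `b₂`, one has
`d(b₁(0), b₂(L₂/2)) ≥ min(L₁,L₃) + L₂/2 − 10R` and
`d(b₁(L₁/2), b₂(L₂/2)) ≥ L₁/2 + L₂/2 − 10R`. -/
theorem thin_compact_maximal_segment_midpoint_estimates
    {X : Type*} [MetricSpace X] {R D : ℝ} (hX : IsThinSpace X R D)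
    (hcpt : IsCompact (Set.univ : Set X))
    {l : ℝ → X} {Λ : ℝ} (hΛ : 10 * R ≤ Λ) (hl : IsSegmentOn l 0 Λ)
    (hmax : ∀ (f : ℝ → X) (a b : ℝ), a ≤ b → IsSegmentOn f a b → b - a ≤ Λ)
    {p : X} (hp : 10 * R ≤ Metric.infDist p (l '' Set.Icc 0 Λ))
    {γ₁ γ₂ : ℝ → X} {L₁ L₂ : ℝ} (hL₁ : 0 ≤ L₁) (hL₂ : 0 ≤ L₂)
    (hγ₁ : IsSegmentOn γ₁ 0 L₁) (hγ₁0 : γ₁ 0 = p) (hγ₁1 : γ₁ L₁ = l Λ)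
    (hγ₂ : IsSegmentOn γ₂ 0 L₂) (hγ₂0 : γ₂ 0 = p) (hγ₂1 : γ₂ L₂ = l 0)
    (b : Fin 3 → ℝ → X) (Len : Fin 3 → ℝ)
    (hb : b = ![γ₁, γ₂, l]) (hLen : Len = ![L₁, L₂, Λ]) :
    ∀ i j m : Fin 3, i ≠ j → j ≠ m → i ≠ m →
      (b i) 0 ∉ (b j) '' Set.Icc 0 (Len j) →
      min (Len i) (Len m) + Len j / 2 - 10 * R ≤
          dist ((b i) 0) ((b j) (Len j / 2)) ∧
        Len i / 2 + Len j / 2 - 10 * R ≤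
          dist ((b i) (Len i / 2)) ((b j) (Len j / 2)) := by
  have hR := hX.R_pos
  have hD := hX.D_pos
  have hRD := hX.twentyD_le_R
  have hΛ0 : 0 ≤ Λ := by linarith
  have hL₁Λ : L₁ ≤ Λ := by simpa using hmax γ₁ 0 L₁ hL₁ hγ₁
  have hL₂Λ : L₂ ≤ Λ := by simpa using hmax γ₂ 0 L₂ hL₂ hγ₂
  have hpΛ : dist p (l Λ) = L₁ := by
    have h := hγ₁ 0 ⟨le_rfl, hL₁⟩ L₁ ⟨hL₁, le_rfl⟩
    rwa [hγ₁0, hγ₁1, zero_sub, abs_neg, abs_of_nonneg hL₁] at h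
  have hp0 : dist p (l 0) = L₂ := by
    have h := hγ₂ 0 ⟨le_rfl, hL₂⟩ L₂ ⟨hL₂, le_rfl⟩
    rwa [hγ₂0, hγ₂1, zero_sub, abs_neg, abs_of_nonneg hL₂] at h
  have hRL₁ : 10 * R ≤ L₁ := hpΛ ▸ hp.trans
    (Metric.infDist_le_dist_of_mem (Set.mem_image_of_mem l (Set.right_mem_Icc.2 hΛ0)))
  have hRL₂ : 10 * R ≤ L₂ := hp0 ▸ hp.trans
    (Metric.infDist_le_dist_of_mem (Set.mem_image_of_mem l (Set.left_mem_Icc.2 hΛ0)))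
  have hpl : min L₁ L₂ + Λ / 2 - 10 * R ≤ dist p (l (Λ / 2)) := by
    have h := hX.min_dist_endpoints_le (by linarith) hl (x := p) (by linarith) (s := Λ / 2)
      ⟨by linarith, by linarith⟩
    rw [sub_half, min_add_add_right, hpΛ, hp0, min_comm] at h
    linarith
  have hmid₁ : L₁ / 2 + Λ / 2 - 10 * R ≤ dist (γ₁ (L₁ / 2)) (l (Λ / 2)) :=
    hX.dist_midpoints_ge hΛ hl hL₁Λ hγ₁ hγ₁1 (by rwa [hγ₁0]) hRL₁
  have hmid₂ : L₂ / 2 + Λ / 2 - 10 * R ≤ dist (γ₂ (L₂ / 2)) (l (Λ / 2)) := by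
    have h := hX.dist_midpoints_ge hΛ hl.reverse hL₂Λ hγ₂ (by simpa using hγ₂1)
      (by rwa [image_reverse_Icc, hγ₂0]) hRL₂
    rwa [sub_half] at h
  have hl0 : min Λ L₂ + L₁ / 2 - 10 * R ≤ dist (l 0) (γ₁ (L₁ / 2)) := by
    have h := hX.dist_opposite_endpoint_midpoint_ge hΛ0 hl hL₁Λ hγ₁ hγ₁1
      (by rwa [hγ₁0]) hRL₁
    rw [hγ₁0, hp0] at h
    linarith
  subst hb hLen
  intro i j m hij hjm him hnot
  fin_cases i <;> fin_cases j <;> fin_cases m <;> simp at hij hjm him hnot ⊢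
  · exact absurd (hγ₂0.trans hγ₁0.symm) (hnot 0 le_rfl hL₂)
  · exact ⟨by rw [hγ₁0]; linarith, by linarith⟩
  · exact absurd (hγ₁0.trans hγ₂0.symm) (hnot 0 le_rfl hL₁)
  · exact ⟨by rw [hγ₂0, min_comm]; linarith, by linarith⟩
  · exact ⟨by linarith, by rw [dist_comm]; linarith⟩
  · exact absurd hγ₂1 (hnot L₂ hL₂ le_rfl)
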